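/- arXiv:0903.0344 — 5 statements merged into one kernel-verified Lean document; each statement's English description precedes it below -/
import Mathlib

section
/- In the algebra B, the left annihilator of np is zero; equivalently, the map ψ₄ : B → B⁷ given by c ↦ (0, 0, 0, 0, c·np, c·np, −c·np) is injective. (This is exactness of the resolution R• of the trivial module at the leftmost stage R⁴.) -/
noncomputable section

open FreeAlgebra

/-- The 13 generators of the algebra `B`. -/
inductive BGen : Type
  | n | p | q | r | s | t | u | v | w | x1 | y1 | a | b

/-- The 14 defining relations of `B`, as a relation on the free algebra
(each generator `g` of the ideal contributes the pair `(g, 0)`). -/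
inductive BRel (k : Type) [Field k] :
    FreeAlgebra k BGen → FreeAlgebra k BGen → Prop
  | np_nq : BRel k (ι k BGen.n * ι k BGen.p - ι k BGen.n * ι k BGen.q) 0
  | np_nr : BRel k (ι k BGen.n * ι k BGen.p - ι k BGen.n * ι k BGen.r) 0
  | ps_pt : BRel k (ι k BGen.p * ι k BGen.s - ι k BGen.p * ι k BGen.t) 0
  | qt_qu : BRel k (ι k BGen.q * ι k BGen.t - ι k BGen.q * ι k BGen.u) 0
  | rs_ru : BRel k (ι k BGen.r * ι k BGen.s - ι k BGen.r * ι k BGen.u) 0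
  | sv_sw : BRel k (ι k BGen.s * ι k BGen.v - ι k BGen.s * ι k BGen.w) 0
  | tw_tx : BRel k (ι k BGen.t * ι k BGen.w - ι k BGen.t * ι k BGen.x1) 0
  | uv_ux : BRel k (ι k BGen.u * ι k BGen.v - ι k BGen.u * ι k BGen.x1) 0
  | sv_sy : BRel k (ι k BGen.s * ι k BGen.v - ι k BGen.s * ι k BGen.y1) 0
  | tw_ty : BRel k (ι k BGen.t * ι k BGen.w - ι k BGen.t * ι k BGen.y1) 0
  | ux_uy : BRel k (ι k BGen.u * ι k BGen.x1 - ι k BGen.u * ι k BGen.y1) 0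
  | va_vb : BRel k (ι k BGen.v * ι k BGen.a - ι k BGen.v * ι k BGen.b) 0
  | wa_wb : BRel k (ι k BGen.w * ι k BGen.a - ι k BGen.w * ι k BGen.b) 0
  | xa_xb : BRel k (ι k BGen.x1 * ι k BGen.a - ι k BGen.x1 * ι k BGen.b) 0

/-- The algebra `B`: the quotient of the free algebra on the 13 generators
by the two-sided ideal generated by the 14 quadratic relations. -/
abbrev Balg (k : Type) [Field k] : Type := RingQuot (BRel k)

/-- The image in `B` of a generator. -/
def bgen (k : Type) [Field k] (g : BGen) : Balg k :=
  RingQuot.mkAlgHom k (BRel k) (ι k g)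

def bn (k : Type) [Field k] : Balg k := bgen k BGen.n
def bp (k : Type) [Field k] : Balg k := bgen k BGen.p
def bq (k : Type) [Field k] : Balg k := bgen k BGen.q
def br (k : Type) [Field k] : Balg k := bgen k BGen.r
def bs (k : Type) [Field k] : Balg k := bgen k BGen.s
def bt (k : Type) [Field k] : Balg k := bgen k BGen.t
def bu (k : Type) [Field k] : Balg k := bgen k BGen.u
def bv (k : Type) [Field k] : Balg k := bgen k BGen.v
def bw (k : Type) [Field k] : Balg k := bgen k BGen.w
def bx1 (k : Type) [Field k] : Balg k := bgen k BGen.x1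
def by1 (k : Type) [Field k] : Balg k := bgen k BGen.y1
def ba (k : Type) [Field k] : Balg k := bgen k BGen.a
def bb (k : Type) [Field k] : Balg k := bgen k BGen.b

/-- The matrix of a generator in the triangular representation of `B` on `B ⊕ B`
whose off-diagonal entry detects right multiplication by `np`. -/
def triGen (k : Type) [Field k] : BGen → Matrix (Fin 2) (Fin 2) (Balg k)
  | .n => !![bn k, 1; 0, 0]
  | .p => !![bp k, 0; 0, 1]
  | .q => !![bq k, 0; 0, 1]
  | .r => !![br k, 0; 0, 1]
  | g => !![bgen k g, 0; 0, 0]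

lemma lift_triGen_rel {k : Type} [Field k] ⦃x y : FreeAlgebra k BGen⦄ (h : BRel k x y) :
    FreeAlgebra.lift k (triGen k) x = FreeAlgebra.lift k (triGen k) y := by
  have h' := RingQuot.mkAlgHom_rel k h
  cases h <;>
  · simp only [map_sub, map_mul, map_zero, FreeAlgebra.lift_ι_apply, triGen, bn, bp, bq, br,
      bgen, sub_eq_zero] at h' ⊢
    simp [h']

/-- The triangular representation of `B` by `2 × 2` matrices over `B`. -/
def triRep (k : Type) [Field k] : Balg k →ₐ[k] Matrix (Fin 2) (Fin 2) (Balg k) :=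
  RingQuot.liftAlgHom k ⟨FreeAlgebra.lift k (triGen k), lift_triGen_rel⟩

@[simp]
lemma triRep_bgen (k : Type) [Field k] (g : BGen) : triRep k (bgen k g) = triGen k g := by
  simp [triRep, bgen]

lemma triRep_diag (k : Type) [Field k] (c : Balg k) :
    triRep k c 0 0 = c ∧ triRep k c 1 0 = 0 := by
  obtain ⟨x, rfl⟩ := RingQuot.mkAlgHom_surjective k (BRel k) c
  induction x using FreeAlgebra.induction with
  | grade0 r => simp [Matrix.algebraMap_matrix_apply]
  | grade1 g =>
    change triRep k (bgen k g) 0 0 = bgen k g ∧ triRep k (bgen k g) 1 0 = 0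
    cases g <;> simp [triGen, bn, bp, bq, br]
  | mul x y hx hy => simp [Matrix.mul_apply, hx, hy]
  | add x y hx hy => simp [hx, hy]

lemma triRep_mul_np (k : Type) [Field k] (c : Balg k) :
    triRep k (c * (bn k * bp k)) 0 1 = c := by
  simp [bn, bp, Matrix.mul_apply, triGen, triRep_diag]

/-- In the algebra `B`, the left annihilator of `np` is zero;
equivalently, the map `ψ₄ : B → B⁷`, `c ↦ (0,0,0,0,c·np,c·np,−c·np)`, is
injective. -/
theorem stmt15 (k : Type) [Field k] :
    (∀ c : Balg k, c * (bn k * bp k) = 0 → c = 0) ∧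
    Function.Injective (fun c : Balg k =>
        (![0, 0, 0, 0, c * (bn k * bp k), c * (bn k * bp k),
           -(c * (bn k * bp k))] : Fin 7 → Balg k)) := by
  have key : ∀ c : Balg k, c * (bn k * bp k) = 0 → c = 0 := fun c hc => by
    rw [← triRep_mul_np k c, hc, map_zero, Matrix.zero_apply]
  refine ⟨key, fun c d h => sub_eq_zero.mp (key _ ?_)⟩
  rw [sub_mul, sub_eq_zero]
  exact congrFun h 4
end
end

section
/- In the algebra B, the kernel of the left B-module map ψ₃ : B⁷ → B¹⁴ (right multiplication by the 7×14 matrix whose rows are: (0,0,n,n,−n,0,0,0,0,0,0,0,0,0); the rows of α' = ((p,0,0,−p,p,0), (0,q,0,0,−q,q), (0,0,r,−r,0,r)) placed in columns 6–11 with zeros elsewhere; and the rows of β' = ((s,−s,0), (0,t,−t), (u,0,−u)) placed in columns 12–14 with zeros elsewhere) equals the image of the map ψ₄ : B → B⁷, c ↦ (0,0,0,0, c·np, c·np, −c·np). (Exactness of the resolution R• at R³.) -/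
noncomputable section

open FreeAlgebra

/-- `BCoincide g h h'` says that `g h - g h'` is one of the defining relations of `B`. -/
inductive BCoincide : BGen → BGen → BGen → Prop
  | np_nq : BCoincide .n .p .q
  | np_nr : BCoincide .n .p .r
  | ps_pt : BCoincide .p .s .t
  | qt_qu : BCoincide .q .t .u
  | rs_ru : BCoincide .r .s .u
  | sv_sw : BCoincide .s .v .w
  | tw_tx : BCoincide .t .w .x1
  | uv_ux : BCoincide .u .v .x1
  | sv_sy : BCoincide .s .v .y1
  | tw_ty : BCoincide .t .w .y1
  | ux_uy : BCoincide .u .x1 .y1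
  | va_vb : BCoincide .v .a .b
  | wa_wb : BCoincide .w .a .b
  | xa_xb : BCoincide .x1 .a .b

namespace BCoincide

theorem rel {k : Type} [Field k] {g h h' : BGen} (H : BCoincide g h h') :
    BRel k (ι k g * ι k h - ι k g * ι k h') 0 := by
  cases H <;> constructor

theorem mul_eq_mul {k : Type} [Field k] {g h h' : BGen} (H : BCoincide g h h') :
    bgen k g * bgen k h = bgen k g * bgen k h' := by
  have := RingQuot.mkAlgHom_rel k (H.rel (k := k))
  simpa [sub_eq_zero, bgen] using this

end BCoincide

theorem BRel.exists_coincide {k : Type} [Field k] {x y : FreeAlgebra k BGen} (H : BRel k x y) :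
    ∃ g h h', BCoincide g h h' ∧ x = ι k g * ι k h - ι k g * ι k h' ∧ y = 0 := by
  cases H <;> exact ⟨_, _, _, by constructor, rfl, rfl⟩

section Derivation

variable {k : Type} [Field k] {M : Type} [AddCommGroup M] [Module k M] [Module (Balg k) M]
  [IsScalarTower k (Balg k) M]

/-- The action of the generator `g` on `M × k` sending `(m, c)` to `(g m + c δ(g), 0)`. -/
def genAction (δ : BGen → M) (g : BGen) : Module.End k (M × k) :=
  LinearMap.inl k M k ∘ₗ
    (Algebra.lsmul k k M (bgen k g)).coprod (LinearMap.toSpanSingleton k M (δ g))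

theorem genAction_apply (δ : BGen → M) (g : BGen) (x : M × k) :
    genAction δ g x = (bgen k g • x.1 + x.2 • δ g, 0) := by
  simp [genAction]

/-- The action of `B` on `M × k` extending `genAction`. -/
def extAction (δ : BGen → M)
    (hδ : ∀ g h h', BCoincide g h h' → bgen k g • δ h = bgen k g • δ h') :
    Balg k →ₐ[k] Module.End k (M × k) :=
  RingQuot.liftAlgHom k ⟨FreeAlgebra.lift k (genAction δ), by
    intro x y hxy
    obtain ⟨g, h, h', H, rfl, rfl⟩ := hxy.exists_coincide
    rw [map_sub, map_zero, sub_eq_zero]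
    ext1 <;> ext1 <;>
    simp [genAction_apply, hδ g h h' H, ← mul_smul, H.mul_eq_mul]⟩

variable {δ : BGen → M} (hδ : ∀ g h h', BCoincide g h h' → bgen k g • δ h = bgen k g • δ h')

theorem extAction_bgen (g : BGen) : extAction δ hδ (bgen k g) = genAction δ g := by
  simp [extAction, bgen]

theorem extAction_inl (e : Balg k) (m : M) : extAction δ hδ e (m, 0) = (e • m, 0) := by
  obtain ⟨x, rfl⟩ := RingQuot.mkAlgHom_surjective k (BRel k) e
  induction x using FreeAlgebra.induction generalizing m with
  | grade0 r => simp
  | grade1 g =>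
    change extAction δ hδ (bgen k g) (m, 0) = (bgen k g • m, 0)
    simp [extAction_bgen, genAction_apply]
  | mul x y hx hy => simp [hx, hy, mul_smul]
  | add x y hx hy => simp [hx, hy, add_smul]

/-- A family `δ` in a left `B`-module that is compatible with the relations of `B` extends to
a linear map on `B` that is `B`-linear on the augmentation ideal. -/
theorem exists_linearMap_mul_bgen
    (hδ : ∀ g h h', BCoincide g h h' → bgen k g • δ h = bgen k g • δ h') :
    ∃ D : Balg k →ₗ[k] M, ∀ e g, D (e * bgen k g) = e • δ g := by
  refine ⟨LinearMap.fst k M k ∘ₗ (LinearMap.applyₗ (0, 1)) ∘ₗ (extAction δ hδ).toLinearMap, ?_⟩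
  intro e g
  simp [extAction_bgen, genAction_apply, extAction_inl]

end Derivation

section Coefficients

variable {k : Type} [Field k]

theorem eq_zero_of_mul_bn_eq_zero {e : Balg k} (h : e * bn k = 0) : e = 0 := by
  obtain ⟨D, hD⟩ := exists_linearMap_mul_bgen (k := k) (M := Balg k)
    (δ := fun | .n => 1 | _ => 0) (by rintro _ _ _ ⟨⟩ <;> simp)
  simpa [bn, hD] using congrArg D h

theorem add_add_eq_zero_of_mul_pqr {c d e : Balg k}
    (h : c * bp k + d * bq k + e * br k = 0) : c + d + e = 0 := by
  obtain ⟨D, hD⟩ := exists_linearMap_mul_bgen (k := k) (M := Balg k)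
    (δ := fun | .p | .q | .r => 1 | _ => 0) (by rintro _ _ _ ⟨⟩ <;> simp)
  simpa [bp, bq, br, hD] using congrArg D h

theorem add_add_eq_zero_of_mul_stu {c d e : Balg k}
    (h : c * bs k + d * bt k + e * bu k = 0) : c + d + e = 0 := by
  obtain ⟨D, hD⟩ := exists_linearMap_mul_bgen (k := k) (M := Balg k)
    (δ := fun | .s | .t | .u => 1 | _ => 0) (by rintro _ _ _ ⟨⟩ <;> simp)
  simpa [bs, bt, bu, hD] using congrArg D h

/-- If every `g` admitting a relation `g h - g h'` that involves the generator `i` lies in the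
left ideal `I`, then the coefficient of `i` modulo `I` is a well-defined linear map. -/
theorem exists_linearMap_mkQ (I : Submodule (Balg k) (Balg k)) (i : BGen)
    (hI : ∀ g h h', BCoincide g h h' → h = i ∨ h' = i → bgen k g ∈ I) :
    ∃ D : Balg k →ₗ[k] Balg k ⧸ I,
      (∀ e, D (e * bgen k i) = I.mkQ e) ∧ ∀ e g, g ≠ i → D (e * bgen k g) = 0 := by
  classical
  obtain ⟨D, hD⟩ := exists_linearMap_mul_bgen (k := k) (M := Balg k ⧸ I)
    (δ := Pi.single i (I.mkQ 1)) (by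
      intro g h h' H
      by_cases hi : h = i ∨ h' = i
      · have hg : bgen k g • I.mkQ 1 = 0 := by
          rw [← map_smul, smul_eq_mul, mul_one]
          simpa using hI g h h' H hi
        simp only [Pi.single_apply]
        split_ifs <;> simp only [hg, smul_zero]
      · push Not at hi
        simp [hi.1, hi.2])
  refine ⟨D, fun e => ?_, fun e g hg => by simp [hD, hg]⟩
  rw [hD, Pi.single_eq_same, ← map_smul, smul_eq_mul, mul_one]

theorem exists_eq_mul_bn_of_mul_bp {c d e : Balg k}
    (h : c * bp k + d * bq k + e * br k = 0) : ∃ f, c = f * bn k := by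
  obtain ⟨D, hD, hD'⟩ := exists_linearMap_mkQ (Submodule.span (Balg k) {bn k}) .p (by
    rintro _ _ _ ⟨⟩ <;> simp [bn, Submodule.mem_span_singleton_self])
  have := congrArg D h
  simp [bp, bq, br, hD, hD', Submodule.mem_span_singleton] at this
  simpa [eq_comm] using this

theorem exists_eq_mul_bn_of_mul_br {c d e : Balg k}
    (h : c * bp k + d * bq k + e * br k = 0) : ∃ f, e = f * bn k := by
  obtain ⟨D, hD, hD'⟩ := exists_linearMap_mkQ (Submodule.span (Balg k) {bn k}) .r (by
    rintro _ _ _ ⟨⟩ <;> simp [bn, Submodule.mem_span_singleton_self])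
  have := congrArg D h
  simp [bp, bq, br, hD, hD', Submodule.mem_span_singleton] at this
  simpa [eq_comm] using this

theorem exists_eq_add_of_mul_bs {c d e : Balg k}
    (h : c * bs k + d * bt k + e * bu k = 0) : ∃ f g, c = f * bp k + g * br k := by
  obtain ⟨D, hD, hD'⟩ := exists_linearMap_mkQ (Submodule.span (Balg k) {bp k, br k}) .s (by
    rintro _ _ _ ⟨⟩ <;> simp [bp, br, Submodule.mem_span_of_mem])
  have := congrArg D h
  simp [bs, bt, bu, hD, hD', Submodule.mem_span_pair] at this
  simpa [eq_comm] using this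

theorem exists_eq_add_of_mul_bt {c d e : Balg k}
    (h : c * bs k + d * bt k + e * bu k = 0) : ∃ f g, d = f * bp k + g * bq k := by
  obtain ⟨D, hD, hD'⟩ := exists_linearMap_mkQ (Submodule.span (Balg k) {bp k, bq k}) .t (by
    rintro _ _ _ ⟨⟩ <;> simp [bp, bq, Submodule.mem_span_of_mem])
  have := congrArg D h
  simp [bs, bt, bu, hD, hD', Submodule.mem_span_pair] at this
  simpa [eq_comm] using this

theorem exists_eq_add_of_mul_bu {c d e : Balg k}
    (h : c * bs k + d * bt k + e * bu k = 0) : ∃ f g, e = f * bq k + g * br k := by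
  obtain ⟨D, hD, hD'⟩ := exists_linearMap_mkQ (Submodule.span (Balg k) {bq k, br k}) .u (by
    rintro _ _ _ ⟨⟩ <;> simp [bq, br, Submodule.mem_span_of_mem])
  have := congrArg D h
  simp [bs, bt, bu, hD, hD', Submodule.mem_span_pair] at this
  simpa [eq_comm] using this

theorem eq_zero_of_mul_bp_eq_zero {e : Balg k} (h : e * bp k = 0) : e = 0 := by
  simpa using add_add_eq_zero_of_mul_pqr (c := e) (d := 0) (e := 0) (by simp [h])

theorem eq_zero_of_mul_bq_eq_zero {e : Balg k} (h : e * bq k = 0) : e = 0 := by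
  simpa using add_add_eq_zero_of_mul_pqr (c := 0) (d := e) (e := 0) (by simp [h])

theorem eq_zero_of_mul_br_eq_zero {e : Balg k} (h : e * br k = 0) : e = 0 := by
  simpa using add_add_eq_zero_of_mul_pqr (c := 0) (d := 0) (e := e) (by simp [h])

theorem bn_mul_bp_eq_bn_mul_bq : bn k * bp k = bn k * bq k := BCoincide.np_nq.mul_eq_mul

theorem bn_mul_bp_eq_bn_mul_br : bn k * bp k = bn k * br k := BCoincide.np_nr.mul_eq_mul

theorem bn_mul_bp_mul_bs_eq_bt : bn k * bp k * bs k = bn k * bp k * bt k := by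
  have h : bp k * bs k = bp k * bt k := BCoincide.ps_pt.mul_eq_mul
  simp [mul_assoc, h]

theorem bn_mul_bp_mul_bt_eq_bu : bn k * bp k * bt k = bn k * bp k * bu k := by
  have h : bq k * bt k = bq k * bu k := BCoincide.qt_qu.mul_eq_mul
  simp [bn_mul_bp_eq_bn_mul_bq, mul_assoc, h]

theorem exists_eq_mul_bn_mul_bp {c d e : Balg k} (hcd : c * bs k = d * bt k)
    (hde : d * bt k = -(e * bu k)) :
    ∃ f, c = f * (bn k * bp k) ∧ d = f * (bn k * bp k) ∧ e = -(f * (bn k * bp k)) := by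
  have hst : c * bs k + (-d) * bt k + 0 * bu k = 0 := by
    rw [neg_mul (α := Balg k), hcd]; simp
  have htu : 0 * bs k + d * bt k + e * bu k = 0 := by simp [hde]
  have hc : c = d := by simpa [← sub_eq_add_neg, sub_eq_zero] using add_add_eq_zero_of_mul_stu hst
  have he : e = -d := by
    simpa [add_comm d, ← eq_neg_iff_add_eq_zero] using add_add_eq_zero_of_mul_stu htu
  subst hc he
  obtain ⟨α, β, hs⟩ := exists_eq_add_of_mul_bs hst
  obtain ⟨γ, ε, ht⟩ := exists_eq_add_of_mul_bt htu
  obtain ⟨ζ, η, hu⟩ := exists_eq_add_of_mul_bu htu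
  obtain ⟨x, hx⟩ := exists_eq_mul_bn_of_mul_bp (c := α) (d := ζ) (e := β + η) (by
    have : α * bp k + ζ * bq k + (β + η) * br k
      = (α * bp k + β * br k) + (ζ * bq k + η * br k) := by noncomm_ring
    rw [this, ← hs, ← hu, add_neg_cancel])
  have hr : c = (x * bn k + β) * br k := by
    rw [hs, hx, mul_assoc, bn_mul_bp_eq_bn_mul_br, add_mul, mul_assoc]
  obtain ⟨f, hf⟩ := exists_eq_mul_bn_of_mul_br (c := -γ) (d := -ε) (e := x * bn k + β) (by
    rw [← hr, ht, neg_mul (α := Balg k), neg_mul (α := Balg k)]; abel)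
  have hc : c = f * (bn k * bp k) := by rw [hr, hf, mul_assoc, bn_mul_bp_eq_bn_mul_br]
  exact ⟨f, hc, hc, by rw [← hc]⟩

end Coefficients

/-- In the algebra `B`, the kernel of the left `B`-module map
`ψ₃ : B⁷ → B¹⁴` equals the image of the map `ψ₄ : B → B⁷`,
`c ↦ (0,0,0,0,c·np,c·np,−c·np)`. (Exactness of the resolution `R•` at `R³`.) -/
theorem stmt16 (k : Type) [Field k] :
    {e : Fin 7 → Balg k |
        (![0, 0, e 0 * bn k, e 0 * bn k, -(e 0 * bn k),
           e 1 * bp k, e 2 * bq k, e 3 * br k,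
           -(e 1 * bp k) - e 3 * br k, e 1 * bp k - e 2 * bq k,
           e 2 * bq k + e 3 * br k,
           e 4 * bs k + e 6 * bu k, -(e 4 * bs k) + e 5 * bt k,
           -(e 5 * bt k) - e 6 * bu k] : Fin 14 → Balg k) = 0}
      = Set.range (fun c : Balg k =>
        (![0, 0, 0, 0, c * (bn k * bp k), c * (bn k * bp k),
           -(c * (bn k * bp k))] : Fin 7 → Balg k)) := by
  ext e
  simp only [Set.mem_ofPred_eq, Set.mem_range]
  constructor
  · intro h
    have h0 : e 0 * bn k = 0 := congrFun h 2
    have h1 : e 1 * bp k = 0 := congrFun h 5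
    have h2 : e 2 * bq k = 0 := congrFun h 6
    have h3 : e 3 * br k = 0 := congrFun h 7
    have h12 : -(e 4 * bs k) + e 5 * bt k = 0 := congrFun h 12
    have h13 : -(e 5 * bt k) - e 6 * bu k = 0 := congrFun h 13
    obtain ⟨f, h4, h5, h6⟩ := exists_eq_mul_bn_mul_bp (neg_add_eq_zero.mp h12)
      (neg_eq_iff_eq_neg.mp (sub_eq_zero.mp h13))
    refine ⟨f, funext fun i => ?_⟩
    fin_cases i
    exacts [(eq_zero_of_mul_bn_eq_zero h0).symm, (eq_zero_of_mul_bp_eq_zero h1).symm,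
      (eq_zero_of_mul_bq_eq_zero h2).symm, (eq_zero_of_mul_br_eq_zero h3).symm,
      h4.symm, h5.symm, h6.symm]
  · rintro ⟨c, rfl⟩
    funext i
    have hneg : -(c * (bn k * bp k)) * bu k = -(c * (bn k * bp k) * bu k) :=
      neg_mul (α := Balg k) _ _
    fin_cases i <;>
      simp [hneg, mul_assoc c, bn_mul_bp_mul_bs_eq_bt, bn_mul_bp_mul_bt_eq_bu]
end
end

section
/- In the algebra B, the kernel of the left B-module map ψ₂ : B¹⁴ → B¹³ equals the image of the map ψ₃ : B⁷ → B¹⁴. Here ψ₂ is right multiplication by the 14×13 block-diagonal matrix with blocks η' = ((0,n,−n,0),(0,n,0,−n)) occupying rows 1–2 and columns 1–4, δ = ((−p,p,0),(0,−q,q),(−r,0,r)) occupying rows 3–5 and columns 5–7, β = ((s,−s,0,0),(0,t,−t,0),(u,0,−u,0),(s,0,0,−s),(0,t,0,−t),(0,0,u,−u)) occupying rows 6–11 and columns 8–11, and (γ',−γ') = ((v,−v),(w,−w),(x₁,−x₁)) occupying rows 12–14 and columns 12–13, and ψ₃ is right multiplication by the 7×14 matrix whose rows are (0,0,n,n,−n,0,…,0),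 the rows of α' = ((p,0,0,−p,p,0),(0,q,0,0,−q,q),(0,0,r,−r,0,r)) in columns 6–11, and the rows of β' = ((s,−s,0),(0,t,−t),(u,0,−u)) in columns 12–14. (Exactness of the resolution R• at R².) -/
noncomputable section

open FreeAlgebra

open BGen

namespace Balg

variable (k : Type) [Field k]

/-- A shortcut instance: instance search does not find it by unification in nested problems. -/
instance instRing : Ring (Balg k) := RingQuot.instRing (BRel k)

/-- The defining relation `g * h - g * h'` with index `i`, as a row vector: its coordinates are the
left coefficients of the final letters. -/
def relRow : Fin 14 → (BGen →₀ Balg k) :=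
  let row (g h h' : BGen) : BGen →₀ Balg k :=
    Finsupp.single h (bgen k g) - Finsupp.single h' (bgen k g)
  ![row n p q, row n p r, row p s t, row q t u, row r s u, row s v w, row t w x1, row u v x1,
    row s v y1, row t w y1, row u x1 y1, row v a b, row w a b, row x1 a b]

/-- The left module of row vectors modulo the defining relations. -/
abbrev RowQuot : Type := (BGen →₀ Balg k) ⧸ Submodule.span (Balg k) (Set.range (relRow k))

/-- The class of a basis vector. -/
def basisClass (g : BGen) : RowQuot k := Submodule.Quotient.mk (Finsupp.single g 1)

variable {k}

theorem bgen_smul_basisClass_eq {g h h' : BGen} (i : Fin 14)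
    (hi : relRow k i = Finsupp.single h (bgen k g) - Finsupp.single h' (bgen k g)) :
    bgen k g • basisClass k h = bgen k g • basisClass k h' := by
  simp only [basisClass, ← Submodule.Quotient.mk_smul, Finsupp.smul_single, smul_eq_mul, mul_one]
  rw [Submodule.Quotient.eq, ← hi]
  exact Submodule.subset_span ⟨i, rfl⟩

variable (k)

/-- The action of a generator on `RowQuot k × k`, combining the module structure with the
Fox derivative. -/
def foxGen (g : BGen) : Module.End k (RowQuot k × k) :=
  LinearMap.prod
    ((Module.toModuleEnd k (RowQuot k) (bgen k g)).comp (LinearMap.fst k _ _) +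
      (LinearMap.toSpanSingleton k _ (basisClass k g)).comp (LinearMap.snd k _ _)) 0

variable {k}

@[simp]
theorem foxGen_apply (g : BGen) (x : RowQuot k × k) :
    foxGen k g x = (bgen k g • x.1 + x.2 • basisClass k g, 0) := rfl

theorem foxGen_mul_eq {g h h' : BGen} (i : Fin 14)
    (hi : relRow k i = Finsupp.single h (bgen k g) - Finsupp.single h' (bgen k g))
    (hB : bgen k g * bgen k h = bgen k g * bgen k h') :
    foxGen k g * foxGen k h - foxGen k g * foxGen k h' = 0 := by
  rw [sub_eq_zero]
  refine LinearMap.ext fun x => ?_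
  simp only [Module.End.mul_apply, foxGen_apply, smul_add, smul_smul, hB,
    smul_comm (bgen k g) x.2, bgen_smul_basisClass_eq i hi]

theorem bgen_mul_eq {g h h' : BGen} (hr : BRel k (ι k g * ι k h - ι k g * ι k h') 0) :
    bgen k g * bgen k h = bgen k g * bgen k h' := by
  have := RingQuot.mkAlgHom_rel k hr
  rw [map_sub, map_zero, map_mul, map_mul] at this
  exact sub_eq_zero.1 this

variable (k)

/-- The action of `B` on `RowQuot k × k` extending `foxGen`. -/
def fox : Balg k →ₐ[k] Module.End k (RowQuot k × k) :=
  RingQuot.liftAlgHom k ⟨FreeAlgebra.lift k (foxGen k), by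
    intro x y hxy
    have key {g h h' : BGen} (i : Fin 14)
        (hi : relRow k i = Finsupp.single h (bgen k g) - Finsupp.single h' (bgen k g))
        (hr : BRel k (ι k g * ι k h - ι k g * ι k h') 0) :=
      foxGen_mul_eq i hi (bgen_mul_eq hr)
    cases hxy <;> simp only [map_sub, map_mul, map_zero, FreeAlgebra.lift_ι_apply]
    exacts [key 0 rfl .np_nq, key 1 rfl .np_nr, key 2 rfl .ps_pt, key 3 rfl .qt_qu,
      key 4 rfl .rs_ru, key 5 rfl .sv_sw, key 6 rfl .tw_tx, key 7 rfl .uv_ux, key 8 rfl .sv_sy,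
      key 9 rfl .tw_ty, key 10 rfl .ux_uy, key 11 rfl .va_vb, key 12 rfl .wa_wb,
      key 13 rfl .xa_xb]⟩

variable {k}

theorem fox_bgen (g : BGen) : fox k (bgen k g) = foxGen k g := by
  simp [fox, bgen]

theorem fox_apply_left (c : Balg k) (m : RowQuot k) : fox k c (m, 0) = (c • m, 0) := by
  obtain ⟨x, rfl⟩ := RingQuot.mkAlgHom_surjective k (BRel k) c
  induction x using FreeAlgebra.induction generalizing m with
  | grade0 c => simp [Module.algebraMap_end_apply]
  | grade1 g =>
    change fox k (bgen k g) _ = (bgen k g • m, 0)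
    rw [fox_bgen]
    change (bgen k g • m + LinearMap.toSpanSingleton k _ (basisClass k g) 0, 0) = _
    rw [map_zero, add_zero]
  | mul x y hx hy => simp [hx, hy, mul_smul]
  | add x y hx hy => simp [hx, hy, add_smul]

/-- A row vector annihilating the column of generators is a combination of the relations. -/
theorem mem_span_relRow {e : BGen →₀ Balg k}
    (he : Finsupp.linearCombination (Balg k) (bgen k) e = 0) :
    e ∈ Submodule.span (Balg k) (Set.range (relRow k)) := by
  have key (f : BGen →₀ Balg k) :
      fox k (Finsupp.linearCombination (Balg k) (bgen k) f) (0, 1) =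
        (Submodule.Quotient.mk f, 0) := by
    induction f using Finsupp.induction_linear with
    | zero => simp; rfl
    | add f g hf hg => simp [hf, hg]
    | single g c =>
      simp [fox_bgen, fox_apply_left, basisClass, ← Submodule.Quotient.mk_smul]
  have h := key e
  rw [he, map_zero] at h
  exact (Submodule.Quotient.mk_eq_zero _).1 (Prod.ext_iff.1 h).1.symm

theorem exists_coeff {e : BGen →₀ Balg k}
    (he : Finsupp.linearCombination (Balg k) (bgen k) e = 0) :
    ∃ c : Fin 14 → Balg k,
      e n = 0 ∧ e p = c 0 * bn k + c 1 * bn k ∧ e q = -(c 0 * bn k) ∧ e r = -(c 1 * bn k) ∧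
      e s = c 2 * bp k + c 4 * br k ∧ e t = -(c 2 * bp k) + c 3 * bq k ∧
      e u = -(c 3 * bq k) - c 4 * br k ∧
      e v = c 5 * bs k + c 7 * bu k + c 8 * bs k ∧
      e w = -(c 5 * bs k) + c 6 * bt k + c 9 * bt k ∧
      e x1 = -(c 6 * bt k) - c 7 * bu k + c 10 * bu k ∧
      e y1 = -(c 8 * bs k) - c 9 * bt k - c 10 * bu k := by
  obtain ⟨c, rfl⟩ := (Submodule.mem_span_range_iff_exists_fun _).1 (mem_span_relRow he)
  refine ⟨c, ?_⟩
  simp [Fin.sum_univ_succ, relRow, bn, bp, bq, br, bs, bt, bu]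
  refine ⟨?_, ?_, ?_, ?_, ?_⟩ <;> abel

theorem mul_bn_eq_zero {x : Balg k} (h : x * bn k = 0) : x = 0 := by
  obtain ⟨c, hc⟩ := exists_coeff (e := .single n x) (by simp; exact h)
  simpa using hc.1

theorem bp_bq_syzygy {x y : Balg k} (h : x * bp k + y * bq k = 0) :
    ∃ f, x = f * bn k ∧ y = -(f * bn k) := by
  obtain ⟨c, -, hp, hq, hr, -⟩ := exists_coeff (e := .single p x + .single q y) (by simp; exact h)
  simp at hp hq hr
  exact ⟨c 0, by rw [hp, hr, add_zero], hq⟩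

theorem bp_br_syzygy {x y : Balg k} (h : x * bp k + y * br k = 0) :
    ∃ f, x = f * bn k ∧ y = -(f * bn k) := by
  obtain ⟨c, -, hp, hq, hr, -⟩ := exists_coeff (e := .single p x + .single r y) (by simp; exact h)
  simp at hp hq hr
  exact ⟨c 1, by rw [hp, hq, zero_add], hr⟩

theorem bq_br_syzygy {x y : Balg k} (h : x * bq k + y * br k = 0) :
    ∃ f, x = f * bn k ∧ y = -(f * bn k) := by
  obtain ⟨c, -, hp, hq, hr, -⟩ := exists_coeff (e := .single q x + .single r y) (by simp; exact h)
  simp at hp hq hr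
  exact ⟨c 1, by rw [hq, ← eq_neg_of_add_eq_zero_right hp.symm], hr⟩

theorem bs_bt_bu_syzygy {x y z : Balg k} (h : x * bs k + y * bt k + z * bu k = 0) :
    ∃ a b c, x = a * bp k + c * br k ∧ y = -(a * bp k) + b * bq k ∧
      z = -(b * bq k) - c * br k := by
  obtain ⟨c, -, -, -, -, hs, ht, hu, -⟩ :=
    exists_coeff (e := .single s x + .single t y + .single u z) (by simp; exact h)
  simp at hs ht hu
  exact ⟨c 2, c 3, c 4, hs, ht, hu⟩

theorem mul_bn_bp (f : Balg k) : f * bn k * bp k = f * bn k * bq k := by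
  rw [mul_assoc, mul_assoc]; exact congrArg (f * ·) (bgen_mul_eq .np_nq)

theorem mul_bn_br (f : Balg k) : f * bn k * br k = f * bn k * bq k := by
  rw [← mul_bn_bp, mul_assoc, mul_assoc]; exact congrArg (f * ·) (bgen_mul_eq .np_nr).symm

theorem mul_bp_bs (f : Balg k) : f * bp k * bs k = f * bp k * bt k := by
  rw [mul_assoc, mul_assoc]; exact congrArg (f * ·) (bgen_mul_eq .ps_pt)

theorem mul_bq_bt (f : Balg k) : f * bq k * bt k = f * bq k * bu k := by
  rw [mul_assoc, mul_assoc]; exact congrArg (f * ·) (bgen_mul_eq .qt_qu)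

theorem mul_br_bs (f : Balg k) : f * br k * bs k = f * br k * bu k := by
  rw [mul_assoc, mul_assoc]; exact congrArg (f * ·) (bgen_mul_eq .rs_ru)

theorem mul_bs_bv (f : Balg k) : f * bs k * bv k = f * bs k * bw k := by
  rw [mul_assoc, mul_assoc]; exact congrArg (f * ·) (bgen_mul_eq .sv_sw)

theorem mul_bt_bw (f : Balg k) : f * bt k * bw k = f * bt k * bx1 k := by
  rw [mul_assoc, mul_assoc]; exact congrArg (f * ·) (bgen_mul_eq .tw_tx)

theorem mul_bu_bv (f : Balg k) : f * bu k * bv k = f * bu k * bx1 k := by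
  rw [mul_assoc, mul_assoc]; exact congrArg (f * ·) (bgen_mul_eq .uv_ux)

theorem bs_bt_syzygy {x y : Balg k} (h : x * bs k + y * bt k = 0) :
    ∃ f, x = f * bp k ∧ y = -(f * bp k) := by
  obtain ⟨a, b, c, rfl, rfl, hz⟩ := bs_bt_bu_syzygy (z := 0) (by simpa using h)
  obtain ⟨f, rfl, hc⟩ := bq_br_syzygy (x := b) (y := c) (by
    rw [← neg_eq_zero, hz]; abel)
  refine ⟨a - f * bn k, ?_, ?_⟩ <;> simp only [hc, sub_mul, neg_mul, mul_bn_br, mul_bn_bp] <;> abel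

theorem bt_bu_syzygy {x y : Balg k} (h : x * bt k + y * bu k = 0) :
    ∃ f, x = f * bq k ∧ y = -(f * bq k) := by
  obtain ⟨a, b, c, hz, rfl, rfl⟩ := bs_bt_bu_syzygy (x := 0) (by simpa using h)
  obtain ⟨f, rfl, hc⟩ := bp_br_syzygy hz.symm
  refine ⟨b - f * bn k, ?_, ?_⟩ <;> simp only [hc, sub_mul, neg_mul, mul_bn_br, mul_bn_bp] <;> abel

theorem bs_bu_syzygy {x y : Balg k} (h : x * bs k + y * bu k = 0) :
    ∃ f, x = f * br k ∧ y = -(f * br k) := by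
  obtain ⟨a, b, c, rfl, hz, rfl⟩ := bs_bt_bu_syzygy (y := 0) (by simpa using h)
  obtain ⟨f, hb, hc⟩ := bp_bq_syzygy (x := -a) (y := b) (by rw [neg_mul, hz])
  obtain rfl := neg_eq_iff_eq_neg.1 hb
  refine ⟨c - f * bn k, ?_, ?_⟩ <;> simp only [hc, sub_mul, neg_mul, mul_bn_br, mul_bn_bp] <;> abel

theorem bv_bw_bx1_syzygy {x y z : Balg k} (h : x * bv k + y * bw k + z * bx1 k = 0) :
    ∃ a b c, x = a * bs k + c * bu k ∧ y = -(a * bs k) + b * bt k ∧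
      z = -(b * bt k) - c * bu k := by
  obtain ⟨c, -, -, -, -, -, -, -, hv, hw, hx, hy⟩ :=
    exists_coeff (e := .single v x + .single w y + .single x1 z) (by simp; exact h)
  simp at hv hw hx hy
  obtain ⟨a, b, d, h8, h9, h10⟩ :=
    bs_bt_bu_syzygy (x := c 8) (y := c 9) (z := c 10) (by rw [← neg_eq_zero, hy]; abel)
  refine ⟨c 5 + a * bp k, c 6 + b * bq k, c 7 + d * br k, ?_, ?_, ?_⟩ <;>
    simp only [hv, hw, hx, h8, h9, h10, add_mul, sub_mul, neg_mul, mul_bp_bs, mul_bq_bt,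
      mul_br_bs] <;> abel

end Balg

/-- In the algebra `B`, the kernel of the left `B`-module map
`ψ₂ : B¹⁴ → B¹³` equals the image of the map `ψ₃ : B⁷ → B¹⁴`.
(Exactness of the resolution `R•` at `R²`.) -/
theorem stmt17 (k : Type) [Field k] :
    {e : Fin 14 → Balg k |
        (![0, e 0 * bn k + e 1 * bn k, -(e 0 * bn k), -(e 1 * bn k),
           -(e 2 * bp k) - e 4 * br k, e 2 * bp k - e 3 * bq k,
           e 3 * bq k + e 4 * br k,
           e 5 * bs k + e 7 * bu k + e 8 * bs k,
           -(e 5 * bs k) + e 6 * bt k + e 9 * bt k,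
           -(e 6 * bt k) - e 7 * bu k + e 10 * bu k,
           -(e 8 * bs k) - e 9 * bt k - e 10 * bu k,
           e 11 * bv k + e 12 * bw k + e 13 * bx1 k,
           -(e 11 * bv k) - e 12 * bw k - e 13 * bx1 k] : Fin 13 → Balg k) = 0}
      = Set.range (fun e : Fin 7 → Balg k =>
        (![0, 0, e 0 * bn k, e 0 * bn k, -(e 0 * bn k),
           e 1 * bp k, e 2 * bq k, e 3 * br k,
           -(e 1 * bp k) - e 3 * br k, e 1 * bp k - e 2 * bq k,
           e 2 * bq k + e 3 * br k,
           e 4 * bs k + e 6 * bu k, -(e 4 * bs k) + e 5 * bt k,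
           -(e 5 * bt k) - e 6 * bu k] : Fin 14 → Balg k)) := by
  ext e
  constructor
  · intro h
    obtain h0 : e 0 = 0 := Balg.mul_bn_eq_zero (neg_eq_zero.1 (congrFun h 2))
    obtain h1 : e 1 = 0 := Balg.mul_bn_eq_zero (neg_eq_zero.1 (congrFun h 3))
    have h4 : -(e 2 * bp k) - e 4 * br k = 0 := congrFun h 4
    have h5 : e 2 * bp k - e 3 * bq k = 0 := congrFun h 5
    have h7 : e 5 * bs k + e 7 * bu k + e 8 * bs k = 0 := congrFun h 7
    have h8 : -(e 5 * bs k) + e 6 * bt k + e 9 * bt k = 0 := congrFun h 8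
    have h9 : -(e 6 * bt k) - e 7 * bu k + e 10 * bu k = 0 := congrFun h 9
    obtain ⟨f, hf2, hf3⟩ := Balg.bp_bq_syzygy (x := e 2) (y := -e 3) (by rw [← h5]; noncomm_ring)
    obtain ⟨g, hg2, hg4⟩ := Balg.bp_br_syzygy (x := e 2) (y := e 4) (by
      rw [← neg_eq_zero, ← h4]; noncomm_ring)
    obtain ⟨a, ha8, ha7⟩ := Balg.bs_bu_syzygy (x := e 5 + e 8) (y := e 7) (by
      rw [← h7]; noncomm_ring)
    obtain ⟨b, hb5, hb9⟩ := Balg.bs_bt_syzygy (x := e 5) (y := -(e 6 + e 9)) (by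
      rw [← neg_eq_zero, ← h8]; noncomm_ring)
    obtain ⟨c, hc6, hc10⟩ := Balg.bt_bu_syzygy (x := e 6) (y := e 7 - e 10) (by
      rw [← neg_eq_zero, ← h9]; noncomm_ring)
    obtain ⟨l, m, d, hl11, hl12, hl13⟩ := Balg.bv_bw_bx1_syzygy (congrFun h 11)
    have h8' : e 8 = -(b * bp k) - -a * br k := by
      rw [eq_sub_of_add_eq' ha8, hb5]; noncomm_ring
    have h9' : e 9 = b * bp k - c * bq k := by
      rw [← hc6, ← neg_injective hb9]; noncomm_ring
    have h10' : e 10 = c * bq k + -a * br k := by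
      rw [neg_mul, ← ha7, ← neg_eq_iff_eq_neg.2 hc10]; noncomm_ring
    refine ⟨![f, b, c, -a, l, m, d], funext fun i => ?_⟩
    fin_cases i
    exacts [h0.symm, h1.symm, hf2.symm, (neg_injective hf3).symm,
      (hg4.trans (congrArg _ (hg2.symm.trans hf2))).symm, hb5.symm, hc6.symm,
      (ha7.trans (neg_mul _ _).symm).symm, h8'.symm, h9'.symm, h10'.symm,
      hl11.symm, hl12.symm, hl13.symm]
  · rintro ⟨f, rfl⟩
    refine funext fun i => ?_
    fin_cases i <;>
      simp [add_mul, sub_mul, Balg.mul_bn_bp, Balg.mul_bn_br, Balg.mul_bp_bs, Balg.mul_bq_bt,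
        Balg.mul_br_bs, Balg.mul_bs_bv, Balg.mul_bt_bw, Balg.mul_bu_bv]
    all_goals abel
end
end

section
/- In the algebra B, the kernel of the left B-module map ψ₁ : B¹³ → B, (c₁,…,c₁₃) ↦ c₁n + c₂p + c₃q + c₄r + c₅s + c₆t + c₇u + c₈v + c₉w + c₁₀x₁ + c₁₁y₁ + c₁₂a + c₁₃b, equals the image of the map ψ₂ : B¹⁴ → B¹³ given by right multiplication by the 14×13 block-diagonal matrix with blocks η' = ((0,n,−n,0),(0,n,0,−n)) in rows 1–2 and columns 1–4, δ = ((−p,p,0),(0,−q,q),(−r,0,r)) in rows 3–5 and columns 5–7, β = ((s,−s,0,0),(0,t,−t,0),(u,0,−u,0),(s,0,0,−s),(0,t,0,−t),(0,0,u,−u)) in rows 6–11 and columns 8–11, and (γ',−γ') = ((v,−v),(w,−w),(x₁,−x₁)) in rows 12–14 and columns 12–13. (Exactness of the resolution R• at R¹.) -/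
noncomputable section

open FreeAlgebra

/-- One step of the right action of the free algebra on `B × M`: `(b, m) ↦ (b * x, b • e)`. -/
def rightStep (k : Type*) {B M : Type*} [CommRing k] [Ring B] [Algebra k B] [AddCommGroup M]
    [Module k M] [Module B M] [IsScalarTower k B M] (x : B) (e : M) : Module.End k (B × M) :=
  LinearMap.prod (LinearMap.mulRight k x ∘ₗ LinearMap.fst k B M)
    ((LinearMap.toSpanSingleton B M e).restrictScalars k ∘ₗ LinearMap.fst k B M)

@[simp]
theorem rightStep_apply (k : Type*) {B M : Type*} [CommRing k] [Ring B] [Algebra k B]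
    [AddCommGroup M] [Module k M] [Module B M] [IsScalarTower k B M] (x : B) (e : M)
    (z : B × M) : rightStep k x e z = (z.1 * x, z.1 • e) := rfl

/-- If the right action given by `rightStep` respects the relations `r`, then there is a
linear map on the quotient algebra sending `b * x` to `b • e x` for every generator `x`. -/
theorem exists_linearMap_mul_generator {k X M : Type*} [CommRing k]
    {r : FreeAlgebra k X → FreeAlgebra k X → Prop} [AddCommGroup M] [Module k M]
    [Module (RingQuot r) M] [IsScalarTower k (RingQuot r) M] (e : X → M)
    (h : ∀ ⦃f g⦄, r f g →
      FreeAlgebra.lift k (fun x => MulOpposite.op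
        (rightStep k (RingQuot.mkAlgHom k r (ι k x)) (e x))) f =
      FreeAlgebra.lift k (fun x => MulOpposite.op
        (rightStep k (RingQuot.mkAlgHom k r (ι k x)) (e x))) g) :
    ∃ D : RingQuot r →ₗ[k] M, ∀ b x, D (b * RingQuot.mkAlgHom k r (ι k x)) = b • e x := by
  set L := FreeAlgebra.lift k (fun x => MulOpposite.op
    (rightStep k (RingQuot.mkAlgHom k r (ι k x)) (e x))) with hL
  let Φ := RingQuot.liftAlgHom k ⟨L, h⟩
  have hΦ (f) : Φ (RingQuot.mkAlgHom k r f) = L f := RingQuot.liftAlgHom_mkAlgHom_apply k L h f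
  have fst_L (f) : ∀ z, ((L f).unop z).1 = z.1 * RingQuot.mkAlgHom k r f := by
    induction f using FreeAlgebra.induction with
    | grade0 c =>
      intro z
      simp [Algebra.algebraMap_eq_smul_one]
    | grade1 x => intro z; simp [hL]
    | mul f g hf hg => intro z; simp [hf, hg, mul_assoc]
    | add f g hf hg => intro z; simp [hf, hg, mul_add]
  refine ⟨LinearMap.snd k _ M ∘ₗ LinearMap.applyₗ ((1, 0) : RingQuot r × M) ∘ₗ
    (MulOpposite.opLinearEquiv k).symm.toLinearMap ∘ₗ Φ.toLinearMap, fun b x => ?_⟩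
  obtain ⟨f, rfl⟩ := RingQuot.mkAlgHom_surjective k r b
  have hx : L (ι k x) = MulOpposite.op (rightStep k (RingQuot.mkAlgHom k r (ι k x)) (e x)) := by
    simp [hL]
  simp [hΦ, hx, fst_L]

theorem bgen_mul_eq {k : Type} [Field k] {x y z : BGen}
    (h : BRel k (ι k x * ι k y - ι k x * ι k z) 0) :
    bgen k x * bgen k y = bgen k x * bgen k z := by
  simpa [sub_eq_zero, bgen] using RingQuot.mkAlgHom_rel k h

/-- The map `ψ₂ : B¹⁴ → B¹³`. -/
def psiTwo (B : Type*) [Ring B] (n p q r s t u v w x : B) : (Fin 14 → B) →ₗ[B] (Fin 13 → B) where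
  toFun e := ![0, e 0 * n + e 1 * n, -(e 0 * n), -(e 1 * n),
    -(e 2 * p) - e 4 * r, e 2 * p - e 3 * q, e 3 * q + e 4 * r,
    e 5 * s + e 7 * u + e 8 * s, -(e 5 * s) + e 6 * t + e 9 * t,
    -(e 6 * t) - e 7 * u + e 10 * u, -(e 8 * s) - e 9 * t - e 10 * u,
    e 11 * v + e 12 * w + e 13 * x, -(e 11 * v) - e 12 * w - e 13 * x]
  map_add' e f := by
    ext i
    fin_cases i <;> simp [add_mul] <;> abel
  map_smul' b e := by
    ext i
    fin_cases i <;> simp [mul_add, mul_sub, mul_assoc]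

set_option maxHeartbeats 1600000 in
theorem psiTwo_single {B : Type*} [Ring B] (n p q r s t u v w x : B) (j : Fin 14) :
    psiTwo B n p q r s t u v w x (Pi.single j 1) =
    (![n • (Pi.single 1 1 - Pi.single 2 1),
      n • (Pi.single 1 1 - Pi.single 3 1),
      p • (Pi.single 5 1 - Pi.single 4 1),
      q • (Pi.single 6 1 - Pi.single 5 1),
      r • (Pi.single 6 1 - Pi.single 4 1),
      s • (Pi.single 7 1 - Pi.single 8 1),
      t • (Pi.single 8 1 - Pi.single 9 1),
      u • (Pi.single 7 1 - Pi.single 9 1),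
      s • (Pi.single 7 1 - Pi.single 10 1),
      t • (Pi.single 8 1 - Pi.single 10 1),
      u • (Pi.single 9 1 - Pi.single 10 1),
      v • (Pi.single 11 1 - Pi.single 12 1),
      w • (Pi.single 11 1 - Pi.single 12 1),
      x • (Pi.single 11 1 - Pi.single 12 1)] : Fin 14 → Fin 13 → B) j := by
  fin_cases j <;> ext i <;> fin_cases i <;> simp [psiTwo]

/-- The composite `ψ₁ ∘ ψ₂` vanishes in any ring satisfying the relations of `B`. -/
theorem psiOne_psiTwo {B : Type*} [Ring B] {n p q r s t u v w x y a b : B}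
    (np_nq : n * p = n * q) (np_nr : n * p = n * r) (ps_pt : p * s = p * t)
    (qt_qu : q * t = q * u) (rs_ru : r * s = r * u) (sv_sw : s * v = s * w)
    (tw_tx : t * w = t * x) (uv_ux : u * v = u * x) (sv_sy : s * v = s * y)
    (tw_ty : t * w = t * y) (ux_uy : u * x = u * y) (va_vb : v * a = v * b)
    (wa_wb : w * a = w * b) (xa_xb : x * a = x * b)
    (e : Fin 14 → B) (c : Fin 13 → B) (hc : psiTwo B n p q r s t u v w x e = c) :
    c 0 * n + c 1 * p + c 2 * q + c 3 * r + c 4 * s + c 5 * t + c 6 * u + c 7 * v + c 8 * w +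
      c 9 * x + c 10 * y + c 11 * a + c 12 * b = 0 := by
  subst hc
  simp [psiTwo, add_mul, sub_mul, mul_assoc, ← np_nq, ← np_nr, ← ps_pt, ← qt_qu, ← rs_ru,
    ← sv_sw, ← tw_tx, ← uv_ux, ← sv_sy, ← tw_ty, ← ux_uy, ← va_vb, ← wa_wb, ← xa_xb]
  abel

/-- The position of a generator in the list `n, p, q, r, s, t, u, v, w, x₁, y₁, a, b`. -/
def BGen.index : BGen → Fin 13
  | n => 0 | p => 1 | q => 2 | r => 3 | s => 4 | t => 5 | u => 6 | v => 7 | w => 8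
  | x1 => 9 | y1 => 10 | a => 11 | b => 12

/-- In the algebra `B`, the kernel of the left `B`-module map
`ψ₁ : B¹³ → B` equals the image of the map `ψ₂ : B¹⁴ → B¹³`.
(Exactness of the resolution `R•` at `R¹`.) -/
theorem stmt18 (k : Type) [Field k] :
    {c : Fin 13 → Balg k |
        c 0 * bn k + c 1 * bp k + c 2 * bq k + c 3 * br k + c 4 * bs k +
          c 5 * bt k + c 6 * bu k + c 7 * bv k + c 8 * bw k + c 9 * bx1 k +
          c 10 * by1 k + c 11 * ba k + c 12 * bb k = 0}
      = Set.range (fun e : Fin 14 → Balg k =>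
        (![0, e 0 * bn k + e 1 * bn k, -(e 0 * bn k), -(e 1 * bn k),
           -(e 2 * bp k) - e 4 * br k, e 2 * bp k - e 3 * bq k,
           e 3 * bq k + e 4 * br k,
           e 5 * bs k + e 7 * bu k + e 8 * bs k,
           -(e 5 * bs k) + e 6 * bt k + e 9 * bt k,
           -(e 6 * bt k) - e 7 * bu k + e 10 * bu k,
           -(e 8 * bs k) - e 9 * bt k - e 10 * bu k,
           e 11 * bv k + e 12 * bw k + e 13 * bx1 k,
           -(e 11 * bv k) - e 12 * bw k - e 13 * bx1 k] : Fin 13 → Balg k)) := by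
  let ψ := psiTwo (Balg k) (bn k) (bp k) (bq k) (br k) (bs k) (bt k) (bu k) (bv k) (bw k) (bx1 k)
  change _ = Set.range ψ
  let e (x : BGen) := (LinearMap.range ψ).mkQ (Pi.single x.index 1)
  let L := FreeAlgebra.lift k (fun x => MulOpposite.op (rightStep k (bgen k x) (e x)))
  have he {x y z : BGen} (j : Fin 14) (hψ : ψ (Pi.single j 1) =
      bgen k x • (Pi.single y.index 1 - Pi.single z.index 1 : Fin 13 → Balg k)) :
      bgen k x • e y = bgen k x • e z := by
    rw [← sub_eq_zero, ← smul_sub, ← map_sub, ← map_smul, ← hψ]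
    simp
  have hL {x y z : BGen} (h : BRel k (ι k x * ι k y - ι k x * ι k z) 0)
      (hxyz : bgen k x • e y = bgen k x • e z) :
      L (ι k x * ι k y - ι k x * ι k z) = L 0 := by
    refine MulOpposite.unop_injective (LinearMap.ext fun m => Prod.ext ?_ ?_)
    · simp [L, mul_assoc, bgen_mul_eq h]
    · simp [L, mul_smul, hxyz]
  ext c
  constructor
  · intro hc
    obtain ⟨D, hD⟩ := exists_linearMap_mul_generator (k := k) (r := BRel k) e (by
      intro f g hfg
      change L f = L g
      cases hfg with
      | np_nq => exact hL .np_nq (he 0 (psiTwo_single ..))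
      | np_nr => exact hL .np_nr (he 1 (psiTwo_single ..))
      | ps_pt => exact hL .ps_pt (he 2 (psiTwo_single ..)).symm
      | qt_qu => exact hL .qt_qu (he 3 (psiTwo_single ..)).symm
      | rs_ru => exact hL .rs_ru (he 4 (psiTwo_single ..)).symm
      | sv_sw => exact hL .sv_sw (he 5 (psiTwo_single ..))
      | tw_tx => exact hL .tw_tx (he 6 (psiTwo_single ..))
      | uv_ux => exact hL .uv_ux (he 7 (psiTwo_single ..))
      | sv_sy => exact hL .sv_sy (he 8 (psiTwo_single ..))
      | tw_ty => exact hL .tw_ty (he 9 (psiTwo_single ..))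
      | ux_uy => exact hL .ux_uy (he 10 (psiTwo_single ..))
      | va_vb => exact hL .va_vb (he 11 (psiTwo_single ..))
      | wa_wb => exact hL .wa_wb (he 12 (psiTwo_single ..))
      | xa_xb => exact hL .xa_xb (he 13 (psiTwo_single ..)))
    change ∀ b x, D (b * bgen k x) = _ at hD
    have hDc := congrArg D hc
    simp only [bn, bp, bq, br, bs, bt, bu, bv, bw, bx1, by1, ba, bb, map_add, map_zero, hD] at hDc
    simp only [e, ← map_smul, ← map_add] at hDc
    rw [Submodule.mkQ_apply, Submodule.Quotient.mk_eq_zero] at hDc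
    suffices hc' : c = _ from hc' ▸ hDc
    ext i
    fin_cases i <;> simp [BGen.index]
  · rintro ⟨e, he⟩
    exact psiOne_psiTwo (bgen_mul_eq .np_nq) (bgen_mul_eq .np_nr) (bgen_mul_eq .ps_pt)
      (bgen_mul_eq .qt_qu) (bgen_mul_eq .rs_ru) (bgen_mul_eq .sv_sw) (bgen_mul_eq .tw_tx)
      (bgen_mul_eq .uv_ux) (bgen_mul_eq .sv_sy) (bgen_mul_eq .tw_ty) (bgen_mul_eq .ux_uy)
      (bgen_mul_eq .va_vb) (bgen_mul_eq .wa_wb) (bgen_mul_eq .xa_xb) e c he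
end
end

section
/- The graded algebra B has Hilbert series H_B(g) = (1 − 13g + 14g² − 7g³ + g⁵)^{-1}; that is, setting h(d) = dim_k B_d (with h(d) = 0 for d < 0), one has h(0) = 1 and, for every n ≥ 1, h(n) − 13·h(n−1) + 14·h(n−2) − 7·h(n−3) + h(n−5) = 0. -/
noncomputable section

open FreeAlgebra

/-- The degree-`d` homogeneous component of `B`: the `k`-linear span of the
images of all products of exactly `d` generators (`B_0 = k·1`). -/
def Bdeg (k : Type) [Field k] (d : ℕ) : Submodule k (Balg k) :=
  Submodule.span k
    {c : Balg k | ∃ l : List BGen, l.length = d ∧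
      c = (l.map (fun g => bgen k g)).prod}

/-- `h(d) = dim_k B_d`, with `h(d) = 0` for `d < 0`. -/
def hdim (k : Type) [Field k] (d : ℤ) : ℕ :=
  if 0 ≤ d then Module.finrank k ↥(Bdeg k d.toNat) else 0

namespace BGen

instance : DecidableEq BGen := fun x y => by
  cases x <;> cases y <;> first | exact isTrue rfl | exact isFalse nofun

instance : Fintype BGen where
  elems := {n, p, q, r, s, t, u, v, w, x1, y1, a, b}
  complete g := by cases g <;> simp

/-- Words are stored last letter first. The letter which replaces `g` when it is appended to the
reduced word `l`, with respect to the completed rewriting system of `B`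
(every rule of which only changes the last letter of its left-hand side). -/
def canon : List BGen → BGen → BGen
  | n :: _, q => p
  | n :: _, r => p
  | p :: n :: _, u => s
  | p :: _, t => s
  | q :: _, u => t
  | r :: _, u => s
  | s :: p :: _, x1 => v
  | s :: r :: _, x1 => v
  | s :: _, w => v
  | s :: _, y1 => v
  | t :: q :: _, w => v
  | t :: q :: _, x1 => v
  | t :: q :: _, y1 => v
  | t :: _, x1 => w
  | t :: _, y1 => w
  | u :: _, x1 => v
  | u :: _, y1 => v
  | v :: _, b => a
  | w :: _, b => a
  | x1 :: _, b => a
  | _, g => g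

/-- Append the letter `g` to the word `l` and reduce. -/
def push (g : BGen) (l : List BGen) : List BGen := canon l g :: l

theorem canon_canon (l : List BGen) (g : BGen) : canon l (canon l g) = canon l g := by
  rcases l with _ | ⟨x, _ | ⟨y, l⟩⟩
  · rfl
  · cases x <;> cases g <;> rfl
  · cases x <;> cases y <;> cases g <;> rfl

/-- The reduced words of length `d`. -/
def normalWords : ℕ → Finset (List BGen)
  | 0 => {[]}
  | d + 1 => ((normalWords d ×ˢ Finset.univ).filter fun x => canon x.1 x.2 = x.2).image
      fun x => x.2 :: x.1

theorem mem_normalWords_succ {d : ℕ} {l : List BGen} :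
    l ∈ normalWords (d + 1) ↔ ∃ l' ∈ normalWords d, ∃ g, canon l' g = g ∧ g :: l' = l := by
  simp [normalWords, and_assoc]

theorem push_mem_normalWords {d : ℕ} {l : List BGen} (hl : l ∈ normalWords d) (g : BGen) :
    push g l ∈ normalWords (d + 1) :=
  mem_normalWords_succ.2 ⟨l, hl, canon l g, canon_canon l g, rfl⟩

theorem length_of_mem_normalWords {d : ℕ} {l : List BGen} (hl : l ∈ normalWords d) :
    l.length = d := by
  induction d generalizing l with
  | zero => simp_all [normalWords]
  | succ d ih =>
    obtain ⟨l', hl', g, -, rfl⟩ := mem_normalWords_succ.1 hl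
    simp [ih hl']

end BGen

section NormalForm

variable (k : Type) [Field k]

/-- The image in `B` of a word, stored last letter first. -/
def wordB (l : List BGen) : Balg k := (l.reverse.map (bgen k)).prod

@[simp] theorem wordB_nil : wordB k [] = 1 := by simp [wordB]

@[simp] theorem wordB_cons (g : BGen) (l : List BGen) :
    wordB k (g :: l) = wordB k l * bgen k g := by simp [wordB]

variable {k} in
theorem mul_bgen_congr {g₁ g₂ g₃ g₄ : BGen}
    (h : BRel k (ι k g₁ * ι k g₂ - ι k g₃ * ι k g₄) 0) (c : Balg k) :
    c * bgen k g₁ * bgen k g₂ = c * bgen k g₃ * bgen k g₄ := by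
  have h' := RingQuot.mkAlgHom_rel k h
  rw [map_sub, map_zero, sub_eq_zero, map_mul, map_mul] at h'
  simp only [mul_assoc, bgen, h']

theorem wordB_push (g : BGen) (l : List BGen) :
    wordB k (BGen.push g l) = wordB k l * bgen k g := by
  have npq := mul_bgen_congr (BRel.np_nq (k := k))
  have npr := mul_bgen_congr (BRel.np_nr (k := k))
  have pst := mul_bgen_congr (BRel.ps_pt (k := k))
  have qtu := mul_bgen_congr (BRel.qt_qu (k := k))
  have rsu := mul_bgen_congr (BRel.rs_ru (k := k))
  have svw := mul_bgen_congr (BRel.sv_sw (k := k))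
  have twx := mul_bgen_congr (BRel.tw_tx (k := k))
  have uvx := mul_bgen_congr (BRel.uv_ux (k := k))
  have svy := mul_bgen_congr (BRel.sv_sy (k := k))
  have twy := mul_bgen_congr (BRel.tw_ty (k := k))
  have uxy := mul_bgen_congr (BRel.ux_uy (k := k))
  have vab := mul_bgen_congr (BRel.va_vb (k := k))
  have wab := mul_bgen_congr (BRel.wa_wb (k := k))
  have xab := mul_bgen_congr (BRel.xa_xb (k := k))
  have nps (c : Balg k) : c * bgen k .n * bgen k .p * bgen k .s =
      c * bgen k .n * bgen k .p * bgen k .u := by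
    rw [pst, npq, qtu]
  have psv (c : Balg k) : c * bgen k .p * bgen k .s * bgen k .v =
      c * bgen k .p * bgen k .s * bgen k .x1 := by
    rw [svw, pst, twx]
  have rsv (c : Balg k) : c * bgen k .r * bgen k .s * bgen k .v =
      c * bgen k .r * bgen k .s * bgen k .x1 := by
    rw [rsu, uvx]
  have qtv (c : Balg k) : c * bgen k .q * bgen k .t * bgen k .v =
      c * bgen k .q * bgen k .t * bgen k .w := by
    rw [twx, qtu, uvx]
  unfold BGen.push BGen.canon
  split <;> simp only [wordB_cons]
  all_goals first
    | exact npq _ | exact npr _ | exact nps _ | exact pst _ | exact qtu _ | exact rsu _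
    | exact psv _ | exact rsv _ | exact svw _ | exact svy _ | exact qtv _
    | exact (qtv _).trans (twx _) | exact (qtv _).trans (twy _) | exact twx _ | exact twy _
    | exact uvx _ | exact (uvx _).trans (uxy _) | exact vab _ | exact wab _ | exact xab _

/-- The operator on formal combinations of words which appends `g` and reduces. -/
def pushLin (g : BGen) : Module.End k (List BGen →₀ k) := Finsupp.lmapDomain k k (BGen.push g)

theorem pushLin_single (g : BGen) (l : List BGen) (c : k) :
    pushLin k g (Finsupp.single l c) = Finsupp.single (BGen.push g l) c := by
  simp [pushLin]

/-- The right action of `B` on formal combinations of words, by appending and reducing. -/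
def rightAction : Balg k →ₐ[k] (Module.End k (List BGen →₀ k))ᵐᵒᵖ :=
  RingQuot.liftAlgHom k ⟨FreeAlgebra.lift k fun g => MulOpposite.op (pushLin k g), by
    intro x y h
    have key (g₁ g₂ g₃ g₄ : BGen)
        (H : ∀ l, BGen.push g₂ (BGen.push g₁ l) = BGen.push g₄ (BGen.push g₃ l)) :
        FreeAlgebra.lift k (fun g => MulOpposite.op (pushLin k g))
          (ι k g₁ * ι k g₂ - ι k g₃ * ι k g₄) =
        FreeAlgebra.lift k (fun g => MulOpposite.op (pushLin k g)) 0 := by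
      rw [map_sub, map_zero, sub_eq_zero, map_mul, map_mul]
      simp only [FreeAlgebra.lift_ι_apply, ← MulOpposite.op_mul]
      congr 1
      refine Finsupp.lhom_ext fun l c => ?_
      simp only [Module.End.mul_apply, pushLin_single, H]
    cases h <;> refine key _ _ _ _ fun l => ?_ <;>
      (rcases l with _ | ⟨x, _ | ⟨y, l⟩⟩
       · rfl
       · cases x <;> rfl
       · cases x <;> cases y <;> rfl)⟩

theorem rightAction_bgen (g : BGen) :
    rightAction k (bgen k g) = MulOpposite.op (pushLin k g) := by
  simp [rightAction, bgen]

/-- The normal form of an element of `B`. -/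
def normalForm : Balg k →ₗ[k] (List BGen →₀ k) where
  toFun x := (rightAction k x).unop (Finsupp.single [] 1)
  map_add' x y := by simp
  map_smul' c x := by simp

theorem normalForm_mul_bgen (x : Balg k) (g : BGen) :
    normalForm k (x * bgen k g) = pushLin k g (normalForm k x) := by
  simp [normalForm, rightAction_bgen]

theorem normalForm_wordB {d : ℕ} {l : List BGen} (hl : l ∈ BGen.normalWords d) :
    normalForm k (wordB k l) = Finsupp.single l 1 := by
  induction d generalizing l with
  | zero =>
    obtain rfl : l = [] := by simpa [BGen.normalWords] using hl
    simp [normalForm]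
  | succ d ih =>
    obtain ⟨l', hl', g, hg, rfl⟩ := BGen.mem_normalWords_succ.1 hl
    rw [wordB_cons, normalForm_mul_bgen, ih hl', pushLin_single, BGen.push, hg]

theorem exists_normalWords_wordB (l : List BGen) :
    ∃ l' ∈ BGen.normalWords l.length, wordB k l' = wordB k l := by
  induction l with
  | nil => exact ⟨[], by simp [BGen.normalWords], rfl⟩
  | cons g l ih =>
    obtain ⟨l', hl', h⟩ := ih
    exact ⟨_, BGen.push_mem_normalWords hl' g, by rw [wordB_push, h, wordB_cons]⟩

theorem Bdeg_eq_span (d : ℕ) :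
    Bdeg k d = Submodule.span k (Set.range fun l : BGen.normalWords d => wordB k l) := by
  unfold Bdeg
  congr 1
  ext c
  constructor
  · rintro ⟨l, rfl, rfl⟩
    obtain ⟨l', hl', h⟩ := exists_normalWords_wordB k l.reverse
    rw [List.length_reverse] at hl'
    exact ⟨⟨l', hl'⟩, by simpa [wordB] using h⟩
  · rintro ⟨⟨l, hl⟩, rfl⟩
    exact ⟨l.reverse, by simp [BGen.length_of_mem_normalWords hl], rfl⟩

theorem linearIndependent_wordB (d : ℕ) :
    LinearIndependent k fun l : BGen.normalWords d => wordB k l := by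
  refine LinearIndependent.of_comp (normalForm k) ?_
  have h : (normalForm k ∘ fun l : BGen.normalWords d => wordB k l) =
      (fun l : List BGen => Finsupp.single l (1 : k)) ∘ Subtype.val :=
    funext fun l => normalForm_wordB k l.2
  rw [h]
  exact (Finsupp.linearIndependent_single_one k _).comp _ Subtype.val_injective

theorem finrank_Bdeg (d : ℕ) : Module.finrank k (Bdeg k d) = (BGen.normalWords d).card := by
  rw [Bdeg_eq_span, finrank_span_eq_card (linearIndependent_wordB k d), Fintype.card_coe]

end NormalForm

namespace BGen

/-- The sum of `φ` over the reduced words of length `d`, which is `0` for `d < 0`. -/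
def wordSum (d : ℤ) : (List BGen → ℤ) →ₗ[ℤ] ℤ where
  toFun φ := if 0 ≤ d then ∑ l ∈ normalWords d.toNat, φ l else 0
  map_add' φ ψ := by split_ifs <;> simp [Finset.sum_add_distrib]
  map_smul' c φ := by split_ifs <;> simp [Finset.mul_sum]

/-- The sum of `φ` over the reduced one-letter extensions of a word. -/
def extSum (φ : List BGen → ℤ) (l : List BGen) : ℤ :=
  ∑ g, if canon l g = g then φ (g :: l) else 0

theorem sum_normalWords_succ (φ : List BGen → ℤ) (d : ℕ) :
    ∑ l ∈ normalWords (d + 1), φ l = ∑ l ∈ normalWords d, extSum φ l := by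
  rw [normalWords, Finset.sum_image, Finset.sum_filter, Finset.sum_product]
  · rfl
  · rintro ⟨l, g⟩ - ⟨l', g'⟩ - h
    simp_all

theorem wordSum_eq_extSum_of_pos (φ : List BGen → ℤ) {d : ℤ} (hd : 1 ≤ d) :
    wordSum d φ = wordSum (d - 1) (extSum φ) := by
  obtain ⟨m, rfl⟩ : ∃ m : ℕ, d = m + 1 := ⟨(d - 1).toNat, by omega⟩
  have h : (0 : ℤ) ≤ m + 1 := by omega
  have h' : ((m : ℤ) + 1).toNat = m + 1 := by omega
  simp [wordSum, h, h', sum_normalWords_succ]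

theorem wordSum_eq_extSum {φ : List BGen → ℤ} (hφ : φ [] = 0) (d : ℤ) :
    wordSum d φ = wordSum (d - 1) (extSum φ) := by
  rcases lt_trichotomy d 0 with hd | rfl | hd
  · have h₁ : ¬ 0 ≤ d := by omega
    have h₂ : ¬ 1 ≤ d := by omega
    simp [wordSum, h₁, h₂]
  · simp [wordSum, normalWords, hφ]
  · exact wordSum_eq_extSum_of_pos φ hd

/-- The indicator function of the words with last letter `g`. -/
def endsIn (g : BGen) : List BGen → ℤ
  | [] => 0
  | x :: _ => if x = g then 1 else 0

/-- The indicator function of the words with last two letters `g₁`, `g₂`. -/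
def endsIn₂ (g₁ g₂ : BGen) : List BGen → ℤ
  | [] => 0
  | x :: l => if x = g₂ then endsIn g₁ l else 0

theorem extSum_endsIn (g : BGen) (l : List BGen) :
    extSum (endsIn g) l = if canon l g = g then 1 else 0 := by
  rw [extSum, Finset.sum_eq_single g]
  · simp [endsIn]
  · intro x _ hx
    simp [endsIn, hx]
  · simp

theorem extSum_endsIn₂ (g₁ g₂ : BGen) (l : List BGen) :
    extSum (endsIn₂ g₁ g₂) l = if canon l g₂ = g₂ then endsIn g₁ l else 0 := by
  rw [extSum, Finset.sum_eq_single g₂]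
  · simp [endsIn₂]
  · intro x _ hx
    simp [endsIn₂, hx]
  · simp

theorem ext_of_last_two {φ ψ : List BGen → ℤ} (h₀ : φ [] = ψ []) (h₁ : ∀ x, φ [x] = ψ [x])
    (h₂ : ∀ x y l, φ (x :: y :: l) = ψ (x :: y :: l)) : φ = ψ := by
  funext l
  rcases l with _ | ⟨x, _ | ⟨y, l⟩⟩
  exacts [h₀, h₁ x, h₂ x y l]

/-- The number of reduced words of length `d`, which is `0` for `d < 0`. -/
def numWords (d : ℤ) : ℤ := wordSum d 1

theorem wordSum_endsIn {g : BGen} {ψ : List BGen → ℤ}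
    (h : (fun l => if canon l g = g then 1 else 0) = ψ) (d : ℤ) :
    wordSum d (endsIn g) = wordSum (d - 1) ψ := by
  rw [wordSum_eq_extSum rfl, ← h, ← funext (extSum_endsIn g)]

theorem wordSum_endsIn₂ {g₁ g₂ : BGen}
    (h : (fun l => if canon l g₂ = g₂ then endsIn g₁ l else 0) = endsIn g₁) (d : ℤ) :
    wordSum d (endsIn₂ g₁ g₂) = wordSum (d - 1) (endsIn g₁) := by
  rw [wordSum_eq_extSum rfl, funext (extSum_endsIn₂ g₁ g₂), h]

theorem extSum_one : extSum 1 = (13 : ℤ) • 1 - (2 : ℤ) • endsIn n - endsIn p - endsIn₂ n p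
    - endsIn q - endsIn r - (2 : ℤ) • endsIn s - endsIn₂ p s - endsIn₂ r s - (2 : ℤ) • endsIn t
    - endsIn₂ q t - (2 : ℤ) • endsIn u - endsIn v - endsIn w - endsIn x1 := by
  refine ext_of_last_two rfl (fun x => ?_) fun x y l => ?_
  · cases x <;> rfl
  · cases x <;> cases y <;> rfl

theorem numWords_recurrence {d : ℤ} (hd : 1 ≤ d) :
    numWords d - 13 * numWords (d - 1) + 14 * numWords (d - 2) - 7 * numWords (d - 3)
      + numWords (d - 5) = 0 := by
  have hn := wordSum_endsIn (g := n) (ψ := 1) (ext_of_last_two rfl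
    (by rintro ⟨⟩ <;> rfl) (by rintro ⟨⟩ ⟨⟩ l <;> rfl))
  have hp := wordSum_endsIn (g := p) (ψ := 1) (ext_of_last_two rfl
    (by rintro ⟨⟩ <;> rfl) (by rintro ⟨⟩ ⟨⟩ l <;> rfl))
  have hs := wordSum_endsIn (g := s) (ψ := 1) (ext_of_last_two rfl
    (by rintro ⟨⟩ <;> rfl) (by rintro ⟨⟩ ⟨⟩ l <;> rfl))
  have hv := wordSum_endsIn (g := v) (ψ := 1) (ext_of_last_two rfl
    (by rintro ⟨⟩ <;> rfl) (by rintro ⟨⟩ ⟨⟩ l <;> rfl))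
  have hq := wordSum_endsIn (g := q) (ψ := 1 - endsIn n) (ext_of_last_two rfl
    (by rintro ⟨⟩ <;> rfl) (by rintro ⟨⟩ ⟨⟩ l <;> rfl))
  have hr := wordSum_endsIn (g := r) (ψ := 1 - endsIn n) (ext_of_last_two rfl
    (by rintro ⟨⟩ <;> rfl) (by rintro ⟨⟩ ⟨⟩ l <;> rfl))
  have ht := wordSum_endsIn (g := t) (ψ := 1 - endsIn p) (ext_of_last_two rfl
    (by rintro ⟨⟩ <;> rfl) (by rintro ⟨⟩ ⟨⟩ l <;> rfl))
  have hu := wordSum_endsIn (g := u) (ψ := 1 - endsIn₂ n p - endsIn q - endsIn r)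
    (ext_of_last_two rfl (by rintro ⟨⟩ <;> rfl) (by rintro ⟨⟩ ⟨⟩ l <;> rfl))
  have hw := wordSum_endsIn (g := w) (ψ := 1 - endsIn s - endsIn₂ q t)
    (ext_of_last_two rfl (by rintro ⟨⟩ <;> rfl) (by rintro ⟨⟩ ⟨⟩ l <;> rfl))
  have hx := wordSum_endsIn (g := x1)
    (ψ := 1 - endsIn₂ p s - endsIn₂ r s - endsIn t - endsIn u)
    (ext_of_last_two rfl (by rintro ⟨⟩ <;> rfl) (by rintro ⟨⟩ ⟨⟩ l <;> rfl))
  have hnp := wordSum_endsIn₂ (g₁ := n) (g₂ := p) (ext_of_last_two rfl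
    (by rintro ⟨⟩ <;> rfl) (by rintro ⟨⟩ ⟨⟩ l <;> rfl))
  have hps := wordSum_endsIn₂ (g₁ := p) (g₂ := s) (ext_of_last_two rfl
    (by rintro ⟨⟩ <;> rfl) (by rintro ⟨⟩ ⟨⟩ l <;> rfl))
  have hrs := wordSum_endsIn₂ (g₁ := r) (g₂ := s) (ext_of_last_two rfl
    (by rintro ⟨⟩ <;> rfl) (by rintro ⟨⟩ ⟨⟩ l <;> rfl))
  have hqt := wordSum_endsIn₂ (g₁ := q) (g₂ := t) (ext_of_last_two rfl
    (by rintro ⟨⟩ <;> rfl) (by rintro ⟨⟩ ⟨⟩ l <;> rfl))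
  have key := wordSum_eq_extSum_of_pos 1 hd
  rw [extSum_one] at key
  simp only [map_sub, map_smul, smul_eq_mul, hn, hp, hs, hv, hq, hr, ht, hu, hw, hx, hnp, hps,
    hrs, hqt] at key
  simp only [sub_sub, Int.reduceAdd] at key
  simp only [numWords]
  linarith

end BGen

theorem hdim_eq_numWords (k : Type) [Field k] (d : ℤ) : (hdim k d : ℤ) = BGen.numWords d := by
  by_cases h : 0 ≤ d <;> simp [hdim, BGen.numWords, BGen.wordSum, h, finrank_Bdeg]

/-- The graded algebra `B` has Hilbert series
`H_B(g) = (1 − 13g + 14g² − 7g³ + g⁵)⁻¹`: `h(0) = 1` and for every `n ≥ 1`,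
`h(n) − 13·h(n−1) + 14·h(n−2) − 7·h(n−3) + h(n−5) = 0`. -/
theorem stmt19 (k : Type) [Field k] :
    hdim k 0 = 1 ∧
    ∀ n : ℤ, 1 ≤ n →
      (hdim k n : ℤ) - 13 * hdim k (n - 1) + 14 * hdim k (n - 2) -
        7 * hdim k (n - 3) + hdim k (n - 5) = 0 := by
  refine ⟨?_, fun n hn => ?_⟩
  · simp [hdim, finrank_Bdeg, BGen.normalWords]
  · simp only [hdim_eq_numWords]
    exact BGen.numWords_recurrence hn
end
end
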